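/- arXiv:2011.13304 — 2 statements merged into one kernel-verified Lean document; each statement's English description precedes it below -/
import Mathlib

section
/- Let E be a finite-dimensional real inner product space and let J be an orthogonal endomorphism of E with J² = −id. Let V ∈ E be a unit vector and let A be a self-adjoint endomorphism of E such that AV = 0, A(JV) = 2·JV, and Au = u for every u ∈ E orthogonal to both V and JV. Then for every subspace W of E with J(W) = W, tr(A|_W) = dim W. -/
/-- The trace of an endomorphism `A` restricted to a subspace `W`,
computed as `∑ᵢ ⟨A uᵢ, uᵢ⟩` for an orthonormal basis `(uᵢ)` of `W`. -/
noncomputable def trRestrict {E : Type*} [NormedAddCommGroup E] [InnerProductSpace ℝ E]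
    [FiniteDimensional ℝ E] (A : E →ₗ[ℝ] E) (W : Submodule ℝ E) : ℝ :=
  ∑ i, (inner ℝ (A ((stdOrthonormalBasis ℝ W i : W) : E))
    ((stdOrthonormalBasis ℝ W i : W) : E) : ℝ)

/-- Let `E` be a finite-dimensional real inner product space with an orthogonal complex
structure `J` (`J² = −id`), let `V` be a unit vector and `A` a self-adjoint
endomorphism with `AV = 0`, `A(JV) = 2 JV`, and `Au = u` for every `u` orthogonal to
both `V` and `JV`. Then for every `J`-invariant subspace `W` of `E`,
`tr(A|_W) = dim W`. -/
theorem trace_on_complex_invariant_subspace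
    {E : Type*} [NormedAddCommGroup E] [InnerProductSpace ℝ E] [FiniteDimensional ℝ E]
    (J : E ≃ₗᵢ[ℝ] E) (hJ : ∀ u : E, J (J u) = -u)
    (V : E) (hV : ‖V‖ = 1)
    (A : E →ₗ[ℝ] E) (hAsym : ∀ u v : E, (inner ℝ (A u) v : ℝ) = inner ℝ u (A v))
    (hAV : A V = 0) (hAJV : A (J V) = (2 : ℝ) • (J V))
    (hperp : ∀ u : E, (inner ℝ u V : ℝ) = 0 → (inner ℝ u (J V) : ℝ) = 0 → A u = u)
    (W : Submodule ℝ E) (hW : Submodule.map J.toLinearEquiv.toLinearMap W = W) :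
    trRestrict A W = (Module.finrank ℝ W : ℝ) := by
  have hJJ : ∀ u v : E, (inner ℝ u (J v) : ℝ) = - inner ℝ (J u) v := by
    intro u v
    have h := J.inner_map_map u (J v)
    rw [hJ, inner_neg_right] at h
    linarith
  have hVV : (inner ℝ V V : ℝ) = 1 := by
    rw [real_inner_self_eq_norm_sq, hV]; norm_num
  have hJVJV : (inner ℝ (J V) (J V) : ℝ) = 1 := by
    rw [J.inner_map_map, hVV]
  have hVJV : (inner ℝ V (J V) : ℝ) = 0 := by
    have h := hJJ V V
    rw [real_inner_comm] at h
    linarith [real_inner_comm V (J V)]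
  have hJVV : (inner ℝ (J V) V : ℝ) = 0 := by rw [real_inner_comm]; exact hVJV
  have hA : ∀ u : E, (inner ℝ (A u) u : ℝ)
      = inner ℝ u u - (inner ℝ u V : ℝ) ^ 2 + (inner ℝ u (J V) : ℝ) ^ 2 := by
    intro u
    have h := hperp (u - (inner ℝ u V : ℝ) • V - (inner ℝ u (J V) : ℝ) • J V)
      (by simp only [inner_sub_left, inner_smul_left, hVV, hJVV]; simp)
      (by simp only [inner_sub_left, inner_smul_left, hVJV, hJVJV]; simp)
    simp only [map_sub, map_smul, hAV, hAJV] at h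
    have h2 : A u = u - (inner ℝ u V : ℝ) • V + (inner ℝ u (J V) : ℝ) • J V := by
      rw [smul_zero, sub_zero, sub_eq_iff_eq_add] at h
      rw [h]; module
    rw [h2, inner_add_left, inner_sub_left, real_inner_smul_left, real_inner_smul_left,
      real_inner_comm u V, real_inner_comm u (J V)]
    ring
  have hJW : ∀ w ∈ W, J w ∈ W := by
    intro w hw
    rw [← hW]
    exact ⟨w, hw, rfl⟩
  set b := stdOrthonormalBasis ℝ W with hb
  have key : ∀ x : W, ∑ i, (inner ℝ ((b i : W) : E) (x : E) : ℝ) ^ 2 = ‖(x : E)‖ ^ 2 := by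
    intro x
    have h := b.sum_sq_norm_inner_right x
    simpa using h
  let p : W := W.orthogonalProjection V
  have hp : ∀ w ∈ W, (inner ℝ w V : ℝ) = inner ℝ w (p : E) := by
    intro w hw
    have h := W.starProjection_inner_eq_zero V w hw
    rw [inner_sub_left, real_inner_comm, real_inner_comm w] at h
    have h' : W.starProjection V = (p : E) := rfl
    rw [h'] at h
    linarith
  have s1 : ∑ i, (inner ℝ ((b i : W) : E) V : ℝ) ^ 2 = ‖(p : E)‖ ^ 2 := by
    rw [← key p]
    exact Finset.sum_congr rfl fun i _ => by rw [hp _ (b i).2]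
  have s2 : ∑ i, (inner ℝ ((b i : W) : E) (J V) : ℝ) ^ 2 = ‖(p : E)‖ ^ 2 := by
    rw [← J.norm_map (p : E), ← key ⟨J p, hJW _ p.2⟩]
    exact Finset.sum_congr rfl fun i _ => by
      rw [hJJ, hp _ (hJW _ (b i).2), ← hJJ]
  have s3 : ∀ i, (inner ℝ ((b i : W) : E) ((b i : W) : E) : ℝ) = 1 := by
    intro i
    rw [real_inner_self_eq_norm_sq, Submodule.norm_coe, b.norm_eq_one]; norm_num
  unfold trRestrict
  rw [← hb]
  simp only [hA, s3]
  rw [Finset.sum_add_distrib, Finset.sum_sub_distrib, s1, s2]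
  simp
end

section
/- Let E be a finite-dimensional real inner product space, and let I and J be orthogonal endomorphisms of E with I² = J² = −id and I∘J = −J∘I; set K = I∘J. Let V ∈ E be a unit vector and let A be a self-adjoint endomorphism of E such that AV = 0, A(IV) = 2·IV, A(JV) = 2·JV, A(KV) = 2·KV, and Au = u for every u ∈ E orthogonal to all of V, IV, JV, KV. Then for every subspace W of E with I(W) = W, J(W) = W and K(W) = W, tr(A|_W) ≥ dim W. -/
/-- Let `E` be a finite-dimensional real inner product space with a quaternionic
structure `I`, `J`, `K = I∘J`. Let `V` be a unit vector and `A` a self-adjoint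
endomorphism with `AV = 0`, `A(IV) = 2 IV`, `A(JV) = 2 JV`, `A(KV) = 2 KV`, and
`Au = u` for all `u` orthogonal to `V, IV, JV, KV`. Then for every subspace `W`
invariant under `I`, `J`, and `K`, `tr(A|_W) ≥ dim W`. -/
theorem trace_on_quaternionic_invariant_subspace
    {E : Type*} [NormedAddCommGroup E] [InnerProductSpace ℝ E] [FiniteDimensional ℝ E]
    (I J : E ≃ₗᵢ[ℝ] E) (hI : ∀ u : E, I (I u) = -u) (hJ : ∀ u : E, J (J u) = -u)
    (hIJ : ∀ u : E, I (J u) = -J (I u))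
    (V : E) (hV : ‖V‖ = 1)
    (A : E →ₗ[ℝ] E) (hAsym : ∀ u v : E, (inner ℝ (A u) v : ℝ) = inner ℝ u (A v))
    (hAV : A V = 0) (hAIV : A (I V) = (2 : ℝ) • (I V))
    (hAJV : A (J V) = (2 : ℝ) • (J V)) (hAKV : A (I (J V)) = (2 : ℝ) • (I (J V)))
    (hperp : ∀ u : E, (inner ℝ u V : ℝ) = 0 → (inner ℝ u (I V) : ℝ) = 0 →
      (inner ℝ u (J V) : ℝ) = 0 → (inner ℝ u (I (J V)) : ℝ) = 0 → A u = u)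
    (W : Submodule ℝ E)
    (hWI : Submodule.map I.toLinearEquiv.toLinearMap W = W)
    (hWJ : Submodule.map J.toLinearEquiv.toLinearMap W = W)
    (hWK : Submodule.map (I.toLinearEquiv.toLinearMap ∘ₗ J.toLinearEquiv.toLinearMap) W
      = W) :
    (Module.finrank ℝ W : ℝ) ≤ trRestrict A W := by
  have gI : ∀ u : E, (inner ℝ (I u) u : ℝ) = 0 := by
    intro u
    have h := I.inner_map_map (I u) u
    rw [hI, inner_neg_left, real_inner_comm] at h
    linarith
  have gJ : ∀ u : E, (inner ℝ (J u) u : ℝ) = 0 := by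
    intro u
    have h := J.inner_map_map (J u) u
    rw [hJ, inner_neg_left, real_inner_comm] at h
    linarith
  have gIJ : (inner ℝ (I V) (J V) : ℝ) = 0 := by
    have h := J.inner_map_map (I V) (J V)
    have h2 := I.inner_map_map (I V) (J V)
    have h3 := hIJ V
    rw [hJ, show J (I V) = - I (J V) by rw [h3, neg_neg], inner_neg_left, inner_neg_right,
      neg_neg] at h
    rw [hI, inner_neg_left, real_inner_comm] at h2
    linarith
  have gK : (inner ℝ (I (J V)) V : ℝ) = 0 := by
    have h2 := I.inner_map_map (I V) (J V)
    rw [hI, inner_neg_left, real_inner_comm, gIJ] at h2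
    linarith
  have o1 := gI V
  have o2 := gJ V
  have o3 : (inner ℝ (I (J V)) (J V) : ℝ) = 0 := gI (J V)
  have o4 : (inner ℝ (I (J V)) (I V) : ℝ) = 0 := by rw [I.inner_map_map]; exact o2
  have o1' := o1
  have o2' := o2
  have o3' := o3
  have o4' := o4
  have gIJ' := gIJ
  have gK' := gK
  rw [real_inner_comm] at o1' o2' o3' o4' gIJ' gK'
  have n0 : (inner ℝ V V : ℝ) = 1 := by rw [real_inner_self_eq_norm_sq, hV]; norm_num
  have n1 : (inner ℝ (I V) (I V) : ℝ) = 1 := by rw [I.inner_map_map, n0]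
  have n2 : (inner ℝ (J V) (J V) : ℝ) = 1 := by rw [J.inner_map_map, n0]
  have n3 : (inner ℝ (I (J V)) (I (J V)) : ℝ) = 1 := by rw [I.inner_map_map, n2]
  have key : ∀ u : E, (inner ℝ (A u) u : ℝ) = inner ℝ u u - (inner ℝ u V : ℝ) ^ 2
      + (inner ℝ u (I V) : ℝ) ^ 2 + (inner ℝ u (J V) : ℝ) ^ 2
      + (inner ℝ u (I (J V)) : ℝ) ^ 2 := by
    intro u
    have hw := hperp (u - (inner ℝ u V : ℝ) • V - (inner ℝ u (I V) : ℝ) • I V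
      - (inner ℝ u (J V) : ℝ) • J V - (inner ℝ u (I (J V)) : ℝ) • I (J V))
      (by simp only [inner_sub_left, real_inner_smul_left, o1, o2, gK, n0]; ring)
      (by simp only [inner_sub_left, real_inner_smul_left, o1', o4, gIJ', n1]; ring)
      (by simp only [inner_sub_left, real_inner_smul_left, o2', o3, gIJ, n2]; ring)
      (by simp only [inner_sub_left, real_inner_smul_left, gK', o3', o4', n3]; ring)
    simp only [map_sub, map_smul, hAV, hAIV, hAJV, hAKV] at hw
    have hA : A u = u - (inner ℝ u V : ℝ) • V + (inner ℝ u (I V) : ℝ) • I V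
      + (inner ℝ u (J V) : ℝ) • J V + (inner ℝ u (I (J V)) : ℝ) • I (J V) := by
      linear_combination (norm := module) hw
    rw [hA]
    simp only [inner_sub_left, inner_add_left, real_inner_smul_left]
    rw [real_inner_comm u V, real_inner_comm u (I V), real_inner_comm u (J V),
      real_inner_comm u (I (J V))]
    ring
  have pars : ∀ x : E, ∑ i, (inner ℝ ((stdOrthonormalBasis ℝ W i : W) : E) x : ℝ) ^ 2
      = ‖W.starProjection x‖ ^ 2 := by
    intro x
    have h := (stdOrthonormalBasis ℝ W).sum_sq_norm_inner_right (W.orthogonalProjectionOnto x)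
    rw [Submodule.starProjection_apply, ← Submodule.coe_norm, ← h]
    refine Finset.sum_congr rfl fun i _ => ?_
    rw [Submodule.inner_orthogonalProjectionOnto_eq_of_mem_left, Real.norm_eq_abs, sq_abs]
  have hproj : ‖W.starProjection (I V)‖ = ‖W.starProjection V‖ := by
    have hmem : ∀ x ∈ W, I x ∈ W := by
      intro x hx
      have : I x ∈ Submodule.map I.toLinearEquiv.toLinearMap W := ⟨x, hx, rfl⟩
      rwa [hWI] at this
    have : W.starProjection (I V) = I (W.starProjection V) := by
      apply Submodule.eq_starProjection_of_mem_of_inner_eq_zero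
      · exact hmem _ (Submodule.starProjection_apply_mem _ _)
      · intro w hw
        rw [← map_sub, ← I.inner_map_map, hI, inner_neg_left,
          Submodule.starProjection_inner_eq_zero _ _ (hmem w hw), neg_zero]
    rw [this, I.norm_map]
  unfold trRestrict
  simp only [key, Finset.sum_add_distrib, Finset.sum_sub_distrib, pars, hproj]
  have hd : ∑ i, (inner ℝ ((stdOrthonormalBasis ℝ W i : W) : E)
      ((stdOrthonormalBasis ℝ W i : W) : E) : ℝ) = Module.finrank ℝ W := by
    have : ∀ i, (inner ℝ ((stdOrthonormalBasis ℝ W i : W) : E)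
      ((stdOrthonormalBasis ℝ W i : W) : E) : ℝ) = 1 := by
      intro i
      rw [← Submodule.coe_inner, real_inner_self_eq_norm_sq, OrthonormalBasis.norm_eq_one, one_pow]
    rw [Finset.sum_congr rfl fun i _ => this i]
    simp
  rw [hd]
  nlinarith [sq_nonneg ‖W.starProjection (J V)‖, sq_nonneg ‖W.starProjection (I (J V))‖]
end
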